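/- arXiv:cs/0502050 — 9 statements merged into one kernel-verified Lean document; each statement's English description precedes it below -/
import Mathlib

section
/- Let n ≥ 1. For v ∈ (ZMod 2)^n let T(v) be the n×n tridiagonal matrix over ZMod 2 with diagonal entries T(v)_{ii} = v_i, entries T(v)_{i,i+1} = T(v)_{i+1,i} = 1, and all other entries 0. Then the number K_n of vectors v ∈ (ZMod 2)^n for which T(v) is invertible satisfies 3·K_n = 2^{n+1} + (-1)^n. -/
/-- The adjacency matrix of the path graph on `n` vertices over `ZMod 2`. -/
def pathAdj (n : ℕ) : Matrix (Fin n) (Fin n) (ZMod 2) :=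
  Matrix.of fun i j => if (i : ℕ) + 1 = (j : ℕ) ∨ (j : ℕ) + 1 = (i : ℕ) then 1 else 0

/-- The tridiagonal matrix with diagonal `v` and `1` on the sub- and super-diagonal. -/
def triDiag (n : ℕ) (v : Fin n → ZMod 2) : Matrix (Fin n) (Fin n) (ZMod 2) :=
  Matrix.of fun i j => if i = j then v i else pathAdj n i j

theorem triDiag_tail (n : ℕ) (v : Fin (n + 1) → ZMod 2) :
    (triDiag (n + 1) v).submatrix Fin.succ Fin.succ = triDiag n (fun i => v i.succ) := by
  ext i j
  simp [triDiag, pathAdj]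

theorem det_rec (n : ℕ) (v : Fin (n + 2) → ZMod 2) :
    (triDiag (n + 2) v).det = v 0 * (triDiag (n + 1) (fun i => v i.succ)).det
      - (triDiag n (fun i => v i.succ.succ)).det := by
  have h2 : ((triDiag (n + 2) v).submatrix Fin.succ (Fin.succAbove 1)).det
      = (triDiag n (fun i => v i.succ.succ)).det := by
    rw [Matrix.det_succ_column_zero, Fin.sum_univ_succ, Finset.sum_eq_zero]
    · have e : ((triDiag (n + 2) v).submatrix Fin.succ (Fin.succAbove 1)).submatrix
          (Fin.succAbove 0) Fin.succ = triDiag n (fun i => v i.succ.succ) := by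
        rw [← triDiag_tail n (fun i => v i.succ), ← triDiag_tail (n + 1) v]
        ext i j
        have : (Fin.succAbove (1 : Fin (n + 2)) j.succ) = j.succ.succ := by
          rw [← Fin.succ_zero_eq_one, Fin.succ_succAbove_succ]; simp
        simp [this]
      rw [e]
      simp [triDiag, pathAdj]
    · intro i _
      simp [triDiag, pathAdj, Fin.ext_iff]
  rw [Matrix.det_succ_row_zero, Fin.sum_univ_succ, Fin.sum_univ_succ, Finset.sum_eq_zero]
  · rw [Fin.succ_zero_eq_one, h2]
    have e : (triDiag (n + 2) v).submatrix Fin.succ (Fin.succAbove 0) =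
        triDiag (n + 1) (fun i => v i.succ) := by
      rw [← triDiag_tail (n + 1) v]; ext i j; simp
    rw [e]
    have a0 : triDiag (n + 2) v 0 0 = v 0 := by simp [triDiag]
    have a1 : triDiag (n + 2) v 0 1 = 1 := by simp [triDiag, pathAdj]
    rw [a0, a1, CharTwo.sub_eq_add]
    simp
  · intro i _
    simp [triDiag, pathAdj, Fin.ext_iff]

theorem det_coprime (n : ℕ) (v : Fin (n + 1) → ZMod 2) :
    (triDiag (n + 1) v).det = 0 → (triDiag n (fun i => v i.succ)).det ≠ 0 := by
  induction n with
  | zero => intro _; simp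
  | succ n ih =>
    intro h h'
    rw [det_rec, h'] at h
    exact ih _ h' (by simpa using h)

theorem count_fiber (n : ℕ) (w : Fin (n + 1) → ZMod 2) :
    (∑ a : ZMod 2, if (triDiag (n + 2) (Fin.cons a w)).det ≠ 0 then (1 : ℤ) else 0)
      = 2 - if (triDiag (n + 1) w).det ≠ 0 then (1 : ℤ) else 0 := by
  have h := det_coprime n w
  simp only [det_rec, Fin.cons_zero, Fin.cons_succ]
  generalize (triDiag (n + 1) w).det = x at *
  generalize (triDiag n (fun i => w i.succ)).det = y at *
  revert x y
  decide

theorem count_rec (n : ℕ) :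
    (∑ v : Fin (n + 2) → ZMod 2, if (triDiag (n + 2) v).det ≠ 0 then (1 : ℤ) else 0)
      = 2 ^ (n + 2)
        - ∑ v : Fin (n + 1) → ZMod 2, if (triDiag (n + 1) v).det ≠ 0 then (1 : ℤ) else 0 := by
  rw [← (Fin.consEquiv (fun _ : Fin (n + 2) => ZMod 2)).sum_comp, Fintype.sum_prod_type_right]
  refine (Finset.sum_congr rfl (fun w _ => count_fiber n w)).trans ?_
  rw [Finset.sum_sub_distrib]
  simp [pow_succ]

theorem count_eq (n : ℕ) :
    (3 : ℤ) * (∑ v : Fin (n + 1) → ZMod 2, if (triDiag (n + 1) v).det ≠ 0 then (1 : ℤ) else 0)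
      = 2 ^ (n + 2) + (-1) ^ (n + 1) := by
  induction n with
  | zero =>
    have h : ∀ v, (triDiag (0 + 1) v).det = v 0 := by
      intro v
      rw [Matrix.det_fin_one]
      simp [triDiag]
    simp only [h]
    decide
  | succ n ih => rw [count_rec, mul_sub, ih]; ring

theorem stmt0 (n : ℕ) (hn : 1 ≤ n) :
    (3 : ℤ) * (Nat.card {v : Fin n → ZMod 2 // IsUnit (triDiag n v)} : ℤ)
      = 2 ^ (n + 1) + (-1) ^ n := by
  obtain ⟨n, rfl⟩ := Nat.exists_eq_add_of_le' hn
  rw [← count_eq n]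
  simp only [Matrix.isUnit_iff_isUnit_det, isUnit_iff_ne_zero]
  rw [Nat.card_eq_fintype_card, Fintype.card_subtype, Finset.sum_boole]
end

section
/- Let n ≥ 1. For v ∈ (ZMod 2)^n let C(v) be the n×n matrix over ZMod 2 with C(v)_{ii} = v_i and C(v)_{ij} = 1 for i ≠ j. Then the number of vectors v ∈ (ZMod 2)^n for which C(v) is invertible equals n if n is odd and n + 1 if n is even; equivalently, 2·K_n = 2n + 1 + (−1)^n. -/
/-- The all-ones-off-diagonal matrix with diagonal replaced by `v`, over `ZMod 2`. -/
def cliqueDiag (n : ℕ) (v : Fin n → ZMod 2) : Matrix (Fin n) (Fin n) (ZMod 2) :=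
  Matrix.of fun i j => if i = j then v i else 1

theorem clique_mulVec (n : ℕ) (v x : Fin n → ZMod 2) (i : Fin n) :
    (cliqueDiag n v).mulVec x i = (∑ j, x j) + (v i + 1) * x i := by
  have h : ∀ j, cliqueDiag n v i j * x j = x j + (if i = j then (v i + 1) * x i else 0) := by
    intro j
    by_cases hij : i = j
    · subst hij
      simp only [cliqueDiag, Matrix.of_apply, if_true]
      have : x i + x i = 0 := CharTwo.add_self_eq_zero _
      linear_combination -this
    · simp [cliqueDiag, hij]
  simp only [Matrix.mulVec, dotProduct, h, Finset.sum_add_distrib]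
  simp

theorem clique_isUnit_iff_ker (n : ℕ) (v : Fin n → ZMod 2) :
    IsUnit (cliqueDiag n v) ↔
      ∀ x : Fin n → ZMod 2, (∀ i, (∑ j, x j) + (v i + 1) * x i = 0) → x = 0 := by
  rw [← Matrix.mulVec_injective_iff_isUnit]
  have := injective_iff_map_eq_zero (Matrix.mulVecLin (cliqueDiag n v))
  simp only [Matrix.coe_mulVecLin] at this
  rw [this]
  refine forall_congr' fun x => ?_
  rw [funext_iff]
  simp only [clique_mulVec, Pi.zero_apply]

theorem zmod_two_cases (a : ZMod 2) : a = 0 ∨ a = 1 := by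
  revert a; decide

theorem clique_isUnit_iff (n : ℕ) (hn : 1 ≤ n) (v : Fin n → ZMod 2) :
    IsUnit (cliqueDiag n v) ↔ (Even n ∧ v = 0) ∨ ∃ i, Pi.single i 1 = v := by
  have two : (1 : ZMod 2) + 1 = 0 := by decide
  constructor
  · intro h
    by_cases hv : v = 0
    · left
      refine ⟨?_, hv⟩
      by_contra hne
      rw [clique_isUnit_iff_ker] at h
      have h1 := h (fun _ => 1) (by
        intro i
        have : ((n : ℕ) : ZMod 2) = 1 :=
          (ZMod.natCast_eq_one_iff_odd).2 (Nat.not_even_iff_odd.1 hne)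
        simp [hv, this, two])
      have := congrFun h1 ⟨0, hn⟩
      simp at this
    · right
      obtain ⟨i, hi⟩ := Function.ne_iff.1 hv
      have hi1 : v i = 1 := (zmod_two_cases (v i)).resolve_left hi
      refine ⟨i, ?_⟩
      funext j
      by_cases hij : j = i
      · subst hij; simp [hi1]
      · rw [Pi.single_eq_of_ne hij]
        rcases zmod_two_cases (v j) with h0 | h0
        · exact h0.symm
        · exfalso
          rw [Matrix.isUnit_iff_isUnit_det] at h
          rw [Matrix.det_zero_of_row_eq (i := i) (j := j) (Ne.symm hij)] at h
          · simp at h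
          · funext k
            simp only [cliqueDiag, Matrix.of_apply, hi1, h0, ite_self]
  · rw [clique_isUnit_iff_ker]
    rintro (⟨he, rfl⟩ | ⟨i, rfl⟩) x hx
    · have h1 : ∀ i, x i = ∑ j, x j := by
        intro i
        have := hx i
        simp only [Pi.zero_apply, zero_add, one_mul] at this
        exact (CharTwo.add_eq_zero.1 this).symm
      have h2 : ∑ j, x j = 0 := by
        generalize hs : ∑ j, x j = s at h1
        rw [← hs]
        have hn0 : ((n : ℕ) : ZMod 2) = 0 := (ZMod.natCast_eq_zero_iff_even).2 he
        simp [h1, hn0]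
      funext i
      rw [h1 i, h2]; rfl
    · have hs : ∑ j, x j = 0 := by
        have := hx i
        simpa [two] using this
      have h1 : ∀ j, j ≠ i → x j = 0 := by
        intro j hj
        have := hx j
        simpa [hs, hj] using this
      rw [Finset.sum_eq_single i (fun j _ hj => h1 j hj) (by simp)] at hs
      funext j
      by_cases hj : j = i
      · rw [hj, hs]; rfl
      · exact h1 j hj

theorem clique_card (n : ℕ) (hn : 1 ≤ n) :
    Nat.card {v : Fin n → ZMod 2 // IsUnit (cliqueDiag n v)}
        = (if Even n then n + 1 else n) := by
  classical
  have hinj : Function.Injective (fun i : Fin n => (Pi.single i 1 : Fin n → ZMod 2)) := by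
    intro i j h
    by_contra hij
    have := congrFun h i
    simp [hij] at this
  have hc : (Finset.univ.image (fun i : Fin n => (Pi.single i 1 : Fin n → ZMod 2))).card = n := by
    rw [Finset.card_image_of_injective _ hinj]; simp
  simp only [clique_isUnit_iff n hn]
  rw [Nat.card_eq_fintype_card, Fintype.card_subtype]
  split_ifs with he
  · have hi := Finset.card_insert_of_notMem (a := (0 : Fin n → ZMod 2))
      (s := Finset.univ.image (fun i : Fin n => (Pi.single i 1 : Fin n → ZMod 2))) (by simp)
    rw [hc] at hi
    refine Eq.trans ?_ hi
    congr 1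
    ext v; simp [he, eq_comm]
  · refine Eq.trans ?_ hc
    congr 1
    ext v; simp [he]

theorem stmt4 (n : ℕ) (hn : 1 ≤ n) :
    Nat.card {v : Fin n → ZMod 2 // IsUnit (cliqueDiag n v)}
        = (if Even n then n + 1 else n) ∧
    (2 : ℤ) * (Nat.card {v : Fin n → ZMod 2 // IsUnit (cliqueDiag n v)} : ℤ)
        = 2 * n + 1 + (-1) ^ n := by
  refine ⟨clique_card n hn, ?_⟩
  rw [clique_card n hn]
  split_ifs with he
  · rw [he.neg_one_pow]; push_cast; ring
  · rw [(Nat.not_even_iff_odd.1 he).neg_one_pow]; ring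
end

section
/- Let n, m ≥ 1 and let Γ be the (n+m)×(n+m) adjacency matrix over ZMod 2 of the n clique-line-m clique graph: Γ_{ij} = 1 whenever i ≠ j and both i,j ∈ {0,…,n−1}, or i ≠ j and both i,j ∈ {n,…,n+m−1}, or {i,j} = {n−1, n}; all other entries are 0. Then the number K of vectors v ∈ (ZMod 2)^{n+m} for which the matrix obtained from Γ by replacing its diagonal with v is invertible satisfies 4·K = 12nm − 2n(1+(−1)^m) − 2m(1+(−1)^n) + 3(1+(−1)^n)(1+(−1)^m). -/
/-- The adjacency matrix over `ZMod 2` of the `n` clique-line-`m` clique graph: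
vertices `0,…,n-1` form a clique, vertices `n,…,n+m-1` form a clique, and there is
an additional edge between `n-1` and `n`. -/
def clcAdj (n m : ℕ) : Matrix (Fin (n + m)) (Fin (n + m)) (ZMod 2) :=
  Matrix.of fun i j =>
    if i ≠ j ∧ (((i : ℕ) < n ∧ (j : ℕ) < n) ∨ (n ≤ (i : ℕ) ∧ n ≤ (j : ℕ)) ∨
        ((i : ℕ) = n - 1 ∧ (j : ℕ) = n) ∨ ((i : ℕ) = n ∧ (j : ℕ) = n - 1))
    then 1 else 0

/-- The matrix `Γ` with its diagonal replaced by `v`. -/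
def withDiag {k : ℕ} (Γ : Matrix (Fin k) (Fin k) (ZMod 2)) (v : Fin k → ZMod 2) :
    Matrix (Fin k) (Fin k) (ZMod 2) :=
  Matrix.of fun i j => if i = j then v i else Γ i j

open Matrix in
lemma det_edge {R : Type*} [CommRing R] {p q : ℕ}
    (A : Matrix (Fin (p+1)) (Fin (p+1)) R) (B : Matrix (Fin (q+1)) (Fin (q+1)) R) :
    (fromBlocks A (single 0 0 1) (single 0 0 1) B).det
      = A.det * B.det - (A.updateRow 0 (Pi.single 0 1)).det * (B.updateRow 0 (Pi.single 0 1)).det := by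
  set M := fromBlocks A (single 0 0 (1:R)) (single 0 0 1) B with hM
  have h1 : M = M.updateRow (Sum.inl 0) (Sum.elim (A 0) 0 +
      (Sum.elim 0 (Pi.single 0 1) : Fin (p+1) ⊕ Fin (q+1) → R)) := by
    ext i j
    rcases i with i | i <;> rcases j with j | j <;>
      by_cases hi : i = 0 <;> simp [hM, updateRow_apply, hi, single_apply, Pi.single_apply, eq_comm]
  have h2 : M.updateRow (Sum.inl 0) (Sum.elim (A 0) 0) = fromBlocks A 0 (single 0 0 1) B := by
    ext i j
    rcases i with i | i <;> rcases j with j | j <;>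
      by_cases hi : i = 0 <;> simp [hM, updateRow_apply, hi, single_apply, eq_comm]
  have h3 : (M.updateRow (Sum.inl 0) (Sum.elim 0 (Pi.single 0 1))).submatrix
      (Equiv.swap (Sum.inl 0) (Sum.inr 0)) id
      = fromBlocks (A.updateRow 0 (Pi.single 0 1)) (of fun i j => if i = 0 then B 0 j else 0) 0
        (B.updateRow 0 (Pi.single 0 1)) := by
    ext i j
    rcases i with i | i <;> rcases j with j | j <;>
      by_cases hi : i = 0 <;>
      simp [hM, updateRow_apply, hi, single_apply, Pi.single_apply, eq_comm, Equiv.swap_apply_def]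
    all_goals (intro h; exact absurd h.symm hi)
  have h4 := congrArg det h3
  rw [det_permute, det_fromBlocks_zero₂₁] at h4
  rw [Equiv.Perm.sign_swap (by simp)] at h4
  rw [h1, det_updateRow_add, h2, det_fromBlocks_zero₁₂, ← h4]
  simp

/-- clique matrix -/
def cl {p : ℕ} (d : Fin p → ZMod 2) : Matrix (Fin p) (Fin p) (ZMod 2) :=
  Matrix.diagonal d + Matrix.of fun _ _ => 1

open Matrix in
lemma det_upd {p : ℕ} (c : ZMod 2) (d : Fin p → ZMod 2) :
    ((cl (Fin.cons c d : Fin (p+1) → ZMod 2)).updateRow 0 (Pi.single 0 1)).det = (cl d).det := by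
  rw [det_succ_row_zero, Fin.sum_univ_succ]
  have : (((cl (Fin.cons c d : Fin (p+1) → ZMod 2)).updateRow 0 (Pi.single 0 1)).submatrix
      Fin.succ (Fin.succAbove 0)) = cl d := by
    ext i j
    simp [cl, updateRow_apply, diagonal_apply]
  rw [this]
  simp

open Matrix in
lemma det_ones {p : ℕ} (c : ZMod 2) (d : Fin p → ZMod 2) :
    ((cl (Fin.cons c d : Fin (p+1) → ZMod 2)).updateRow 0 (fun _ => 1)).det = ∏ i, d i := by
  have : ((cl (Fin.cons c d : Fin (p+1) → ZMod 2)).updateRow 0 (fun _ => 1)).det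
     = (of (Fin.cons (fun _ => 1) (fun i => Fin.cons 0 (diagonal d i)) :
        Fin (p+1) → Fin (p+1) → ZMod 2)).det := by
    apply det_eq_of_forall_row_eq_smul_add_const (fun i => if i = 0 then 0 else 1) 0 (by simp)
    intro i j
    refine Fin.cases ?_ (fun i => ?_) i <;> refine Fin.cases ?_ (fun j => ?_) j <;>
      simp [cl, updateRow_apply, diagonal_apply]
  rw [this, det_of_isUpperTriangular]
  · simp [Fin.prod_univ_succ]
  · intro i j hij
    revert hij
    refine Fin.cases ?_ (fun i => ?_) i <;> refine Fin.cases ?_ (fun j => ?_) j <;>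
      simp [diagonal_apply]
    intro h h'
    exact absurd h' (ne_of_gt h)

open Matrix in
lemma det_cl_cons {p : ℕ} (c : ZMod 2) (d : Fin p → ZMod 2) :
    (cl (Fin.cons c d : Fin (p+1) → ZMod 2)).det = c * (cl d).det + ∏ i, d i := by
  have h : cl (Fin.cons c d : Fin (p+1) → ZMod 2) =
      (cl (Fin.cons c d : Fin (p+1) → ZMod 2)).updateRow 0
        (c • (Pi.single 0 1 : Fin (p+1) → ZMod 2) + fun _ => 1) := by
    ext i j
    by_cases hi : i = 0
    · subst hi
      by_cases hj : j = 0
      · subst hj; simp [cl]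
      · simp [cl, diagonal_apply, hj, Ne.symm hj]
    · simp [updateRow_apply, hi]
  rw [h, det_updateRow_add, det_updateRow_smul, det_upd, det_ones]

lemma sum_cons {p : ℕ} (F : (Fin (p+1) → ZMod 2) → ℤ) :
    ∑ d, F d = ∑ d : Fin p → ZMod 2, (F (Fin.cons 0 d) + F (Fin.cons 1 d)) := by
  rw [← (Fin.consEquiv (fun _ : Fin (p+1) => ZMod 2)).sum_comp, Fintype.sum_prod_type]
  rw [Finset.sum_add_distrib]
  exact Fin.sum_univ_two (fun c : Fin 2 => ∑ d : Fin p → ZMod 2, F (Fin.cons (c : ZMod 2) d))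

lemma z2 (x : ZMod 2) : x + 1 + 1 = x := by revert x; decide

lemma sum_cl (p : ℕ) (F : ZMod 2 → ZMod 2 → ℤ) :
    ∑ d : Fin p → ZMod 2, F (∏ i, d i) (cl d).det
      = F 1 (p + 1) + p * F 0 1 + (2 ^ p - p - 1) * F 0 0 := by
  induction p generalizing F with
  | zero => simp
  | succ p ih =>
    rw [sum_cons]
    simp only [det_cl_cons, Fin.prod_univ_succ, Fin.cons_zero, Fin.cons_succ, zero_mul, one_mul,
      zero_add]
    rw [ih (fun x y => F 0 x + F x (y + x))]
    push_cast
    simp only [add_zero]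
    ring

/-- weighted count -/
def wt (p : ℕ) (F : ZMod 2 → ZMod 2 → ℤ) : ℤ :=
  F 1 (p + 1) + p * F 0 1 + (2 ^ p - p - 1) * F 0 0

lemma wt_eq (p : ℕ) (F : ZMod 2 → ZMod 2 → ℤ) :
    wt p F = ∑ d : Fin p → ZMod 2, F (∏ i, d i) (cl d).det := (sum_cl p F).symm

/-- indicator -/
def ind (x : ZMod 2) : ℤ := if x = 1 then 1 else 0

lemma key (p q : ℕ) :
    ∑ d : Fin (p+1) → ZMod 2, ∑ e : Fin (q+1) → ZMod 2,
      ind ((cl d).det * (cl e).det - ((cl d).updateRow 0 (Pi.single 0 1)).det *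
        ((cl e).updateRow 0 (Pi.single 0 1)).det) =
    wt p (fun x y => wt q
        (fun z w => ind (x * z - y * w) + ind (x * (w + z) - y * w)
          + (ind ((y + x) * z - y * w) + ind ((y + x) * (w + z) - y * w)))) := by
  rw [sum_cons]
  simp only [sum_cons (p := q), det_cl_cons, det_upd, ← Finset.sum_add_distrib, zero_mul, one_mul,
      zero_add]
  simp only [wt_eq]

lemma clc_sub (p q : ℕ) (v : Fin (p + 1 + (q + 1)) → ZMod 2) :
    (withDiag (clcAdj (p+1) (q+1)) v).submatrix
      ((Equiv.sumCongr Fin.revPerm (Equiv.refl _)).trans finSumFinEquiv)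
      ((Equiv.sumCongr Fin.revPerm (Equiv.refl _)).trans finSumFinEquiv) =
    Matrix.fromBlocks (cl fun i => v (Fin.castAdd _ i.rev) + 1) (Matrix.single 0 0 1)
      (Matrix.single 0 0 1) (cl fun i => v (Fin.natAdd _ i) + 1) := by
  ext i j
  rcases i with i | i <;> rcases j with j | j
  · by_cases h : i = j
    · subst h; simp [withDiag, cl, z2]
    · simp [withDiag, clcAdj, cl, h, Matrix.diagonal_apply]
  · have h1 : Fin.castAdd (q+1) i.rev ≠ Fin.natAdd (p+1) j := by
      intro h; have := congrArg Fin.val h; simp at this; omega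
    have h2 : ((0 = i ∧ 0 = j) ↔ (p - i.val = p ∧ j.val = 0)) := by
      rw [Fin.ext_iff, Fin.ext_iff, Fin.val_zero, Fin.val_zero]; omega
    simp [withDiag, clcAdj, h1, Matrix.single_apply, h2]
    congr 1
    simp; omega
  · have h1 : Fin.natAdd (p+1) i ≠ Fin.castAdd (q+1) j.rev := by
      intro h; have := congrArg Fin.val h; simp at this; omega
    have h2 : ((0 = i ∧ 0 = j) ↔ (i.val = 0 ∧ p - j.val = p)) := by
      rw [Fin.ext_iff, Fin.ext_iff, Fin.val_zero, Fin.val_zero]; omega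
    simp [withDiag, clcAdj, h1, Matrix.single_apply, h2]
    congr 1
    simp; omega
  · by_cases h : i = j
    · subst h; simp [withDiag, cl, z2]
    · simp [withDiag, clcAdj, cl, h, Matrix.diagonal_apply]
      omega

/-- reparametrisation of diagonals -/
def vEquiv (p q : ℕ) : (Fin (p + 1 + (q + 1)) → ZMod 2) ≃
    (Fin (p+1) → ZMod 2) × (Fin (q+1) → ZMod 2) where
  toFun v := (fun i => v (Fin.castAdd _ i.rev) + 1, fun i => v (Fin.natAdd _ i) + 1)
  invFun x := Fin.append (fun i => x.1 i.rev + 1) (fun i => x.2 i + 1)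
  left_inv v := by
    ext i
    refine Fin.addCases (fun i => ?_) (fun i => ?_) i <;> simp [z2]
  right_inv x := by
    ext i <;> simp [z2]

lemma card_eq (p q : ℕ) :
    (Nat.card {v : Fin (p + 1 + (q + 1)) → ZMod 2 //
        IsUnit (withDiag (clcAdj (p+1) (q+1)) v)} : ℤ) =
    ∑ d : Fin (p+1) → ZMod 2, ∑ e : Fin (q+1) → ZMod 2,
      ind ((cl d).det * (cl e).det - ((cl d).updateRow 0 (Pi.single 0 1)).det *
        ((cl e).updateRow 0 (Pi.single 0 1)).det) := by
  classical
  rw [Nat.card_eq_fintype_card, Fintype.card_subtype, Finset.card_filter, ← Fintype.sum_prod_type',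
    ← (vEquiv p q).sum_comp]
  push_cast
  refine Finset.sum_congr rfl fun v _ => ?_
  have hu : ∀ x : ZMod 2, IsUnit x ↔ x = 1 := by
    intro x; rw [isUnit_iff_ne_zero]; revert x; decide
  rw [ind]
  congr 1
  rw [Matrix.isUnit_iff_isUnit_det, hu, ← det_edge, ← Matrix.det_submatrix_equiv_self
    ((Equiv.sumCongr Fin.revPerm (Equiv.refl _)).trans finSumFinEquiv), clc_sub]
  rfl

theorem stmt5 (n m : ℕ) (hn : 1 ≤ n) (hm : 1 ≤ m) :
    (4 : ℤ) * (Nat.card {v : Fin (n + m) → ZMod 2 // IsUnit (withDiag (clcAdj n m) v)} : ℤ)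
      = 12 * n * m - 2 * n * (1 + (-1) ^ m) - 2 * m * (1 + (-1) ^ n)
        + 3 * (1 + (-1) ^ n) * (1 + (-1) ^ m) := by
  obtain ⟨p, rfl⟩ : ∃ p, n = p + 1 := ⟨n - 1, by omega⟩
  obtain ⟨q, rfl⟩ : ∃ q, m = q + 1 := ⟨m - 1, by omega⟩
  rw [card_eq, key]
  simp only [wt]
  have par : ∀ p : ℕ, ((p : ZMod 2) = 0 ∧ (-1 : ℤ) ^ p = 1) ∨ ((p : ZMod 2) = 1 ∧ (-1 : ℤ) ^ p = -1) := by
    intro p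
    rcases Nat.even_or_odd p with h | h
    · exact Or.inl ⟨(ZMod.natCast_eq_zero_iff_even).2 h, h.neg_one_pow⟩
    · exact Or.inr ⟨(ZMod.natCast_eq_one_iff_odd).2 h, h.neg_one_pow⟩
  have i0 : ind 0 = 0 := rfl
  have i1 : ind 1 = 1 := rfl
  have e2 : (1 : ZMod 2) + 1 = 0 := rfl
  have e3 : (-1 : ZMod 2) = 1 := rfl
  rcases par p with ⟨h1, h2⟩ | ⟨h1, h2⟩ <;> rcases par q with ⟨h3, h4⟩ | ⟨h3, h4⟩ <;>
    simp only [h1, h2, h3, h4, pow_succ, e2, zero_add, add_zero, mul_zero, zero_mul, mul_one,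
      one_mul, sub_zero, sub_self, zero_sub, e3, i0, i1] <;> push_cast <;> ring
end

section
/- Let n ≥ 0 and let Γ be the n×n adjacency matrix over ZMod 2 of the path graph (Γ_{ij} = 1 iff |i − j| = 1). Then the number of subsets S ⊆ Fin n such that the principal submatrix of Γ obtained by deleting the rows and columns indexed by S is invertible over ZMod 2 equals the Fibonacci number Fib(n+1) (with Fib(1) = Fib(2) = 1, so the count is 1 for n = 0 and n = 1), i.e. it satisfies the recurrence K_n = K_{n−1} + K_{n−2} with K_0 = K_1 = 1. -/
/-- The principal submatrix of `Γ` obtained by deleting the rows and columns indexed by `S`,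
i.e. the submatrix indexed by the complement of `S`. -/
def prinSub {k : ℕ} (Γ : Matrix (Fin k) (Fin k) (ZMod 2)) (S : Finset (Fin k)) :
    Matrix {i // i ∈ Sᶜ} {i // i ∈ Sᶜ} (ZMod 2) :=
  Γ.submatrix Subtype.val Subtype.val

/-- Kernel formulation of invertibility: `f i` says that vertex `i` is kept; `v (i+1)` is the
entry of the vector at vertex `i`. -/
def PGood (f : ℕ → Bool) : Prop :=
  ∀ v : ℕ → ZMod 2, v 0 = 0 → (∀ i, f i = false → v (i + 1) = 0) →
    (∀ i, f i = true → v i + v (i + 2) = 0) → ∀ i, v i = 0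

/-- Extension of a boolean vector by `false`. -/
def pext {n : ℕ} (g : Fin n → Bool) (i : ℕ) : Bool := if h : i < n then g ⟨i, h⟩ else false

theorem pext_cons_zero {n : ℕ} (a : Bool) (g : Fin n → Bool) :
    pext (Fin.cons a g : Fin (n + 1) → Bool) 0 = a := by
  simp [pext]

theorem pext_cons_succ {n : ℕ} (a : Bool) (g : Fin n → Bool) (i : ℕ) :
    pext (Fin.cons a g : Fin (n + 1) → Bool) (i + 1) = pext g i := by
  unfold pext
  by_cases h : i < n
  · have h' : i + 1 < n + 1 := by omega
    rw [dif_pos h, dif_pos h']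
    exact Fin.cons_succ (α := fun _ => Bool) a g ⟨i, h⟩
  · have h' : ¬ i + 1 < n + 1 := by omega
    rw [dif_neg h, dif_neg h']

theorem good_false (f : ℕ → Bool) (h0 : f 0 = false) :
    PGood f ↔ PGood (fun i => f (i + 1)) := by
  constructor
  · intro h v hv0 hv1 hv2 i
    have := h (fun k => if k = 0 then 0 else v (k - 1)) (by simp)
      (by
        intro i hi
        rcases i with _ | i
        · simpa using hv0
        · simpa using hv1 i hi)
      (by
        intro i hi
        rcases i with _ | i
        · simp [h0] at hi
        · simpa using hv2 i hi) (i + 1)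
    simpa using this
  · intro h v hv0 hv1 hv2 i
    have := h (fun k => v (k + 1)) (hv1 0 h0) (fun i hi => hv1 (i + 1) hi)
      (fun i hi => hv2 (i + 1) hi)
    rcases i with _ | i
    · exact hv0
    · exact this i

theorem good_true_true (f : ℕ → Bool) (h0 : f 0 = true) (h1 : f 1 = true) :
    PGood f ↔ PGood (fun i => f (i + 2)) := by
  constructor
  · intro h v hv0 hv1 hv2 i
    have := h (fun k => if k = 0 then 0 else if k = 1 then - v 1 else v (k - 2)) (by simp)
      (by
        intro i hi
        rcases i with _ | _ | i
        · simp [h0] at hi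
        · simp [h1] at hi
        · simpa using hv1 i hi)
      (by
        intro i hi
        rcases i with _ | _ | i
        · simpa using hv0
        · simp [CharTwo.add_self_eq_zero]
        · simpa using hv2 i hi) (i + 2)
    simpa using this
  · intro h v hv0 hv1 hv2 i
    have e0 := hv2 0 h0
    have e1 := hv2 1 h1
    rw [hv0, zero_add] at e0
    have := h (fun k => v (k + 2)) e0 (fun i hi => hv1 (i + 2) hi)
      (fun i hi => hv2 (i + 2) hi)
    rcases i with _ | _ | i
    · exact hv0
    · have h3 := this 1
      simp only [Nat.reduceAdd] at h3 e1
      rw [h3, add_zero] at e1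
      exact e1
    · exact this i

theorem good_true_false (f : ℕ → Bool) (h0 : f 0 = true) (h1 : f 1 = false) : ¬ PGood f := by
  intro h
  have := h (fun k => if k = 1 then 1 else 0) (by simp)
      (by
        intro i hi
        rcases i with _ | i
        · simp [h0] at hi
        · simp)
      (by
        intro i hi
        rcases i with _ | _ | i
        · simp
        · simp [h1] at hi
        · simp) 1
  simp at this

open Classical in
theorem pcount (n : ℕ) :
    (Finset.univ.filter fun g : Fin n → Bool => PGood (pext g)).card = Nat.fib (n + 1) := by
  induction n using Nat.twoStepInduction with
  | zero =>
    have : PGood (pext (default : Fin 0 → Bool)) := by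
      intro v h0 h1 _ i
      rcases i with _ | i
      · exact h0
      · exact h1 i (by simp [pext])
    rw [Finset.filter_true_of_mem]
    · simp
    · intro g _
      rwa [Subsingleton.elim g default]
  | one =>
    have : (Finset.univ.filter fun g : Fin 1 → Bool => PGood (pext g)) = {fun _ => false} := by
      ext g
      simp only [Finset.mem_filter, Finset.mem_univ, true_and, Finset.mem_singleton]
      constructor
      · intro h
        funext i
        rw [Subsingleton.elim i 0]
        by_contra h0
        exact good_true_false (pext g) (by simpa [pext] using h0) (by simp [pext]) h
      · rintro rfl v h0 h1 _ i
        rcases i with _ | i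
        · exact h0
        · exact h1 i (by simp [pext])
    rw [this]
    simp
  | more n ih1 ih2 =>
    have key : (Finset.univ.filter fun g : Fin (n + 2) → Bool => PGood (pext g)) =
        ((Finset.univ.filter fun g : Fin (n + 1) → Bool => PGood (pext g)).image
          (fun g => (Fin.cons false g : Fin (n + 2) → Bool))) ∪
        ((Finset.univ.filter fun g : Fin n → Bool => PGood (pext g)).image
          (fun g => (Fin.cons true (Fin.cons true g : Fin (n + 1) → Bool) :
            Fin (n + 2) → Bool))) := by
      have eF : ∀ g : Fin (n + 1) → Bool,
          PGood (pext (Fin.cons false g : Fin (n + 2) → Bool)) ↔ PGood (pext g) := by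
        intro g
        rw [good_false _ (pext_cons_zero _ _)]
        simp only [pext_cons_succ]
      have eT : ∀ g : Fin n → Bool,
          PGood (pext (Fin.cons true (Fin.cons true g : Fin (n + 1) → Bool) :
            Fin (n + 2) → Bool)) ↔ PGood (pext g) := by
        intro g
        rw [good_true_true _ (pext_cons_zero _ _)
          ((pext_cons_succ _ _ 0).trans (pext_cons_zero _ _))]
        have : ∀ i, pext (Fin.cons true (Fin.cons true g : Fin (n + 1) → Bool) :
            Fin (n + 2) → Bool) (i + 2) = pext g i := fun i =>
          (pext_cons_succ _ _ (i + 1)).trans (pext_cons_succ _ _ i)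
        simp only [this]
      ext g
      simp only [Finset.mem_filter, Finset.mem_univ, true_and, Finset.mem_union,
        Finset.mem_image]
      constructor
      · intro h
        induction g using Fin.consCases with
        | _ a g =>
        cases a
        · exact Or.inl ⟨g, (eF g).1 h, rfl⟩
        · right
          induction g using Fin.consCases with
          | _ b g =>
          cases b
          · exact absurd h (good_true_false _ (pext_cons_zero _ _)
              ((pext_cons_succ _ _ 0).trans (pext_cons_zero _ _)))
          · exact ⟨g, (eT g).1 h, rfl⟩
      · rintro (⟨g, h, rfl⟩ | ⟨g, h, rfl⟩)
        · exact (eF g).2 h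
        · exact (eT g).2 h
    rw [key, Finset.card_union_of_disjoint, Finset.card_image_of_injective,
      Finset.card_image_of_injective, ih1, ih2, Nat.fib_add_two (n := n + 1), add_comm]
    · intro a b h
      exact Fin.cons_right_injective (α := fun _ => Bool) _
        (Fin.cons_right_injective (α := fun _ => Bool) _ h)
    · exact Fin.cons_right_injective (α := fun _ => Bool) _
    · rw [Finset.disjoint_left]
      intro g h1 h2
      simp only [Finset.mem_image] at h1 h2
      obtain ⟨a, -, rfl⟩ := h1
      obtain ⟨b, -, hb⟩ := h2
      have := congrFun hb 0
      simp at this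

theorem path_sum {n : ℕ} (S : Finset (Fin n)) (v : ℕ → ZMod 2) (hv0 : v 0 = 0)
    (hv : ∀ i, pext (fun i => decide (i ∉ S)) i = false → v (i + 1) = 0)
    (i : {i // i ∈ Sᶜ}) :
    (prinSub (pathAdj n) S).mulVec (fun j => v (j.1.1 + 1)) i = v i.1.1 + v (i.1.1 + 2) := by
  obtain ⟨⟨i, hi⟩, hiS⟩ := i
  have hn : v (i + 2) = if i + 1 < n then v (i + 2) else 0 := by
    split_ifs with h
    · rfl
    · exact hv (i + 1) (by simp [pext, h])
  simp only [Matrix.mulVec, dotProduct, prinSub, Matrix.submatrix_apply, pathAdj, Matrix.of_apply]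
  rw [Finset.sum_coe_sort Sᶜ (fun j : Fin n =>
    (if i + 1 = (j : ℕ) ∨ (j : ℕ) + 1 = i then (1 : ZMod 2) else 0) * v (j + 1))]
  rw [Finset.sum_subset (Finset.subset_univ _)]
  · rw [Fin.sum_univ_eq_sum_range (fun j : ℕ =>
      (if i + 1 = j ∨ j + 1 = i then (1 : ZMod 2) else 0) * v (j + 1)) n]
    have : ∀ j, (if i + 1 = j ∨ j + 1 = i then (1 : ZMod 2) else 0) * v (j + 1) =
        (if j + 1 = i then v i else 0) + (if i + 1 = j then v (i + 2) else 0) := by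
      intro j
      by_cases h1 : j + 1 = i
      · have : ¬ i + 1 = j := by omega
        simp [h1, this]
      · by_cases h2 : i + 1 = j
        · subst h2
          simp
          omega
        · simp [h1, h2]
    simp only [this, Finset.sum_add_distrib]
    rw [Finset.sum_ite_eq, hn]
    congr 1
    · rcases i with _ | i
      · simp [hv0]
      · simp only [Nat.add_right_cancel_iff]
        rw [Finset.sum_ite_eq']
        rw [if_pos (by simp; omega)]
    · simp
      intros
      omega
  · intro j _ hj
    rw [hv j (by simpa [pext] using hj), mul_zero]

theorem isUnit_iff_good {n : ℕ} (S : Finset (Fin n)) :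
    IsUnit (prinSub (pathAdj n) S) ↔ PGood (pext (fun i => decide (i ∉ S))) := by
  rw [← Matrix.mulVec_injective_iff_isUnit]
  constructor
  · intro h v hv0 hv1 hv2 i
    have h0 : (fun j : {i // i ∈ Sᶜ} => v (j.1.1 + 1)) = 0 := by
      apply h
      rw [Matrix.mulVec_zero]
      funext j
      rw [path_sum S v hv0 hv1 j]
      exact hv2 j.1.1 (by
        have hj := Finset.mem_compl.1 j.2
        simpa [pext] using hj)
    rcases i with _ | i
    · exact hv0
    · cases hf : pext (fun i => decide (i ∉ S)) i
      · exact hv1 i hf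
      · by_cases hi : i < n
        · have hm : (⟨i, hi⟩ : Fin n) ∈ Sᶜ := by simpa [pext, hi] using hf
          exact congrFun h0 ⟨⟨i, hi⟩, hm⟩
        · simp [pext, hi] at hf
  · intro h a b hab
    rw [← sub_eq_zero]
    have hw : (prinSub (pathAdj n) S).mulVec (a - b) = 0 := by
      rw [Matrix.mulVec_sub]
      exact sub_eq_zero.2 hab
    generalize a - b = w at hw
    let v : ℕ → ZMod 2 := fun k =>
      match k with
      | 0 => 0
      | k + 1 => if h : ∃ hk : k < n, (⟨k, hk⟩ : Fin n) ∈ Sᶜ then w ⟨⟨k, h.1⟩, h.2⟩ else 0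
    have hvw : (fun j : {i // i ∈ Sᶜ} => v (j.1.1 + 1)) = w := by
      funext j
      exact dif_pos ⟨j.1.2, j.2⟩
    have hv1 : ∀ i, pext (fun i => decide (i ∉ S)) i = false → v (i + 1) = 0 := by
      intro i hi
      apply dif_neg
      rintro ⟨hk, hm⟩
      simp [pext, hk] at hi
      simp [hi] at hm
    have := h v rfl hv1 (by
      intro i hi
      by_cases hk : i < n
      · have hm : (⟨i, hk⟩ : Fin n) ∈ Sᶜ := by simpa [pext, hk] using hi
        have := path_sum S v rfl hv1 ⟨⟨i, hk⟩, hm⟩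
        rw [hvw, hw] at this
        exact this.symm
      · simp [pext, hk] at hi)
    rw [← hvw]
    funext j
    exact this (j.1.1 + 1)

theorem stmt6 (n : ℕ) :
    Nat.card {S : Finset (Fin n) // IsUnit (prinSub (pathAdj n) S)} = Nat.fib (n + 1) := by
  classical
  rw [← pcount n, ← Fintype.card_subtype, ← Nat.card_eq_fintype_card]
  refine Nat.card_congr ⟨fun S => ⟨fun i => decide (i ∉ S.1), (isUnit_iff_good S.1).1 S.2⟩,
    fun g => ⟨Finset.univ.filter fun i => g.1 i = false, ?_⟩, ?_, ?_⟩
  · rw [isUnit_iff_good]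
    convert g.2 using 2
    funext i
    simp
  · intro S
    ext i
    simp
  · intro g
    ext i
    simp
end

section
/- Let n ≥ 0, let Γ be the n×n adjacency matrix over ZMod 2 of the path graph (Γ_{ij} = 1 iff |i−j| = 1), and let S ⊆ Fin n. Then the principal submatrix of Γ obtained by deleting the rows and columns indexed by S is invertible over ZMod 2 if and only if every maximal interval of consecutive indices contained in the complement of S has even cardinality. -/
theorem range_sum_aux (n i : ℕ) (F : ℕ → ZMod 2) (hF : ∀ k, n ≤ k → F k = 0) :
    ∑ j ∈ Finset.range n, (if i + 1 = j ∨ j + 1 = i then (1 : ZMod 2) else 0) * F j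
      = F (i + 1) + (if i = 0 then 0 else F (i - 1)) := by
  have h1 : ∀ j ∈ Finset.range n,
      (if i + 1 = j ∨ j + 1 = i then (1 : ZMod 2) else 0) * F j
      = (if i + 1 = j then F j else 0) + (if j + 1 = i then F j else 0) := by
    intro j _
    by_cases h : i + 1 = j
    · have : ¬ j + 1 = i := by omega
      simp [h, this]
    · simp [h]
  rw [Finset.sum_congr rfl h1, Finset.sum_add_distrib, Finset.sum_ite_eq]
  congr 1
  · split_ifs with h
    · rfl
    · exact (hF _ (by simpa using h)).symm
  · rcases i with _ | i
    · simp
    · simp only [add_left_inj, Finset.sum_ite_eq', Finset.mem_range]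
      rw [if_neg (Nat.succ_ne_zero i), Nat.add_sub_cancel]
      split_ifs with h
      · rfl
      · exact (hF _ (by omega)).symm

theorem mulVec_aux (n : ℕ) (S : Finset (Fin n)) (F : ℕ → ZMod 2)
    (hn : ∀ k, n ≤ k → F k = 0) (hS : ∀ k : Fin n, k ∈ S → F k = 0) (i : {i // i ∈ Sᶜ}) :
    (prinSub (pathAdj n) S).mulVec (fun j => F (j : Fin n)) i
      = F ((i : Fin n) + 1) + (if ((i : Fin n) : ℕ) = 0 then 0 else F ((i : Fin n) - 1)) := by
  rw [← range_sum_aux n _ F hn, ← Fin.sum_univ_eq_sum_range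
    (fun j => (if ((i : Fin n) : ℕ) + 1 = j ∨ j + 1 = ((i : Fin n) : ℕ) then (1 : ZMod 2) else 0) * F j)]
  simp only [Matrix.mulVec, dotProduct, prinSub, pathAdj, Matrix.submatrix_apply, Matrix.of_apply]
  rw [Finset.sum_coe_sort Sᶜ (fun j : Fin n =>
    (if ((i : Fin n) : ℕ) + 1 = j ∨ (j : ℕ) + 1 = ((i : Fin n) : ℕ) then (1 : ZMod 2) else 0) * F j)]
  apply Finset.sum_subset (Finset.subset_univ _)
  intro x _ hx
  rw [hS x (by simpa using hx), mul_zero]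

theorem isUnit_iff_aux (n : ℕ) (S : Finset (Fin n)) :
    IsUnit (prinSub (pathAdj n) S) ↔ ∀ F : ℕ → ZMod 2, (∀ k, n ≤ k → F k = 0) →
      (∀ k : Fin n, k ∈ S → F k = 0) →
      (∀ i : Fin n, i ∉ S → F (i + 1) + (if (i : ℕ) = 0 then 0 else F (i - 1)) = 0) →
      ∀ k, F k = 0 := by
  rw [← Matrix.mulVec_injective_iff_isUnit]
  constructor
  · intro h F hn hS hF k
    have h0 : (fun j : {i // i ∈ Sᶜ} => F (j : Fin n)) = 0 := by
      apply h
      rw [Matrix.mulVec_zero]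
      ext i
      rw [mulVec_aux n S F hn hS]
      simpa using hF i (Finset.mem_compl.1 i.2)
    by_cases hk : n ≤ k
    · exact hn k hk
    · by_cases hk' : (⟨k, by omega⟩ : Fin n) ∈ S
      · exact hS _ hk'
      · exact congrFun h0 ⟨⟨k, by omega⟩, by simpa using hk'⟩
  · intro h
    have h2 : ∀ v, (prinSub (pathAdj n) S).mulVec v = 0 → v = 0 := by
      intro v hv
      classical
      set F : ℕ → ZMod 2 := fun k =>
        if h : ∃ hk : k < n, (⟨k, hk⟩ : Fin n) ∈ Sᶜ then v ⟨⟨k, h.1⟩, h.2⟩ else 0 with hFdef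
      have hvF : v = fun j : {i // i ∈ Sᶜ} => F (j : Fin n) := by
        ext j
        have : ∃ hk : ((j : Fin n) : ℕ) < n, (⟨j, hk⟩ : Fin n) ∈ Sᶜ := ⟨j.1.2, j.2⟩
        simp only [hFdef]
        rw [dif_pos this]
      have hn : ∀ k, n ≤ k → F k = 0 := by
        intro k hk
        simp only [hFdef]
        rw [dif_neg]
        rintro ⟨h, _⟩
        omega
      have hS : ∀ k : Fin n, k ∈ S → F k = 0 := by
        intro k hk
        simp only [hFdef]
        rw [dif_neg]
        rintro ⟨_, h⟩
        exact (Finset.mem_compl.1 h) hk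
      have hz := h F hn hS (by
        intro i hi
        rw [← mulVec_aux n S F hn hS ⟨i, by simpa using hi⟩, ← hvF, hv]
        rfl)
      rw [hvF]
      ext j
      exact hz _
    intro v w hvw
    have := h2 (v - w) (by rw [Matrix.mulVec_sub]; exact sub_eq_zero.2 hvw)
    exact sub_eq_zero.1 this

theorem run_start (P : ℕ → Prop) (x : ℕ) (hx : P x) :
    ∃ a, a ≤ x ∧ (∀ i, a ≤ i → i ≤ x → P i) ∧ ∀ a', a' + 1 = a → ¬ P a' := by
  induction x with
  | zero => exact ⟨0, le_rfl, fun i _ h => by simpa [Nat.le_zero.1 h] using hx, by omega⟩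
  | succ x ih =>
    by_cases h : P x
    · obtain ⟨a, h1, h2, h3⟩ := ih h
      refine ⟨a, by omega, fun i hi hi' => ?_, h3⟩
      rcases Nat.lt_or_ge x i with h' | h'
      · rwa [show i = x + 1 by omega]
      · exact h2 i hi h'
    · refine ⟨x + 1, le_rfl, fun i hi hi' => ?_, fun a' ha' => ?_⟩
      · rwa [show i = x + 1 by omega]
      · rwa [show a' = x by omega]

theorem run_end (P : ℕ → Prop) (n : ℕ) (hn : ∀ k, n ≤ k → ¬ P k) (x : ℕ) (hx : P x) :
    ∃ b, x ≤ b ∧ (∀ i, x ≤ i → i ≤ b → P i) ∧ ¬ P (b + 1) := by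
  classical
  have hex : ∃ d, ¬ P (x + d) := ⟨n, hn _ (by omega)⟩
  have h0 : Nat.find hex ≠ 0 := by
    intro h
    have := Nat.find_spec hex
    rw [h] at this
    exact this hx
  refine ⟨x + Nat.find hex - 1, by omega, fun i hi hi' => ?_, ?_⟩
  · have := Nat.find_min hex (m := i - x) (by omega)
    rw [show x + (i - x) = i by omega] at this
    exact not_not.1 this
  · rw [show x + Nat.find hex - 1 + 1 = x + Nat.find hex by omega]
    exact Nat.find_spec hex

theorem stmt7 (n : ℕ) (S : Finset (Fin n)) :
    IsUnit (prinSub (pathAdj n) S) ↔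
      ∀ a b : Fin n, a ≤ b → (∀ i ∈ Finset.Icc a b, i ∉ S) →
        (∀ a' : Fin n, (a' : ℕ) + 1 = (a : ℕ) → a' ∈ S) →
        (∀ b' : Fin n, (b : ℕ) + 1 = (b' : ℕ) → b' ∈ S) →
        Even (Finset.Icc a b).card := by
  rw [isUnit_iff_aux]
  constructor
  · intro h a b hab hI ha hb
    by_contra hodd
    rw [Fin.card_Icc, Nat.not_even_iff] at hodd
    have hab' : (a : ℕ) ≤ b := hab
    have := h (fun k => if (a : ℕ) ≤ k ∧ k ≤ b ∧ (k - a) % 2 = 0 then 1 else 0) ?_ ?_ ?_ a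
    · simp [hab] at this
    · intro k hk
      have := b.2
      exact if_neg (by omega)
    · intro k hk
      refine if_neg ?_
      rintro ⟨h1, h2, _⟩
      exact hI k (Finset.mem_Icc.2 ⟨h1, h2⟩) hk
    · intro i hi
      have h1 : (i : ℕ) + 1 ≠ a := fun h => hi (ha i h)
      have h2 : (b : ℕ) + 1 ≠ i := fun h => hi (hb i h)
      have h11 : (1 : ZMod 2) + 1 = 0 := by decide
      by_cases hc : (a : ℕ) ≤ i ∧ (i : ℕ) ≤ b ∧ (i - a : ℕ) % 2 = 1
      · rw [if_pos (by omega), if_neg (by omega), if_pos (by omega), h11]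
      · rw [if_neg (by omega)]
        split_ifs with h3 h4
        · simp
        · omega
        · simp
  · intro h F hn hS hF x
    by_contra hx
    set P : ℕ → Prop := fun k => ∃ hk : k < n, (⟨k, hk⟩ : Fin n) ∉ S with hP
    have hP0 : ∀ k, ¬ P k → F k = 0 := by
      intro k hk
      by_cases hkn : n ≤ k
      · exact hn k hkn
      · by_contra h0
        exact hk ⟨by omega, fun hs => h0 (hS _ hs)⟩
    have hPx : P x := by
      by_contra h0
      exact hx (hP0 x h0)
    have hst : ∀ i, P (i + 1) → F (i + 2) = F i := by
      intro i ⟨h1, h2⟩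
      have := hF _ h2
      simp only [Nat.add_one_ne_zero, if_false, Nat.add_sub_cancel] at this
      rw [add_eq_zero_iff_eq_neg, ZMod.neg_eq_self_mod_two] at this
      exact this
    have hst0 : P 0 → F 1 = 0 := by
      intro ⟨h1, h2⟩
      simpa using hF _ h2
    obtain ⟨a, ha, haI, haS⟩ := run_start P x hPx
    obtain ⟨b, hb, hbI, hbS⟩ := run_end P n (fun k hk ⟨h, _⟩ => by omega) x hPx
    have hI : ∀ i, a ≤ i → i ≤ b → P i := by
      intro i h1 h2
      rcases le_total i x with h3 | h3
      · exact haI i h1 h3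
      · exact hbI i h3 h2
    obtain ⟨han, _⟩ := hI a le_rfl (by omega)
    obtain ⟨hbn, _⟩ := hI b (by omega) le_rfl
    have hev := h ⟨a, han⟩ ⟨b, hbn⟩ (by simp only [Fin.mk_le_mk]; omega)
      (by
        intro i hi
        rw [Finset.mem_Icc] at hi
        exact (hI i hi.1 hi.2).2)
      (by
        intro a' ha'
        by_contra h0
        exact haS a' ha' ⟨a'.2, h0⟩)
      (by
        intro b' hb'
        by_contra h0
        apply hbS
        simp only at hb'
        rw [hb']
        exact ⟨b'.2, h0⟩)
    rw [Fin.card_Icc, Nat.even_iff] at hev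
    simp only at hev
    have hup : ∀ k, a + 2 * k + 1 ≤ b + 1 → F (a + 2 * k + 1) = 0 := by
      intro k
      induction k with
      | zero =>
        intro _
        rcases a with _ | a
        · exact hst0 (hI 0 le_rfl (by omega))
        · have := hst a (hI _ le_rfl (by omega))
          exact this.trans (hP0 a (haS a rfl))
      | succ k ih =>
        intro hk
        have := hst (a + 2 * k + 1) (hI _ (by omega) (by omega))
        exact this.trans (ih (by omega))
    have hdn : ∀ k y, y + 2 * k = b + 1 → a ≤ y → F y = 0 := by
      intro k
      induction k with
      | zero =>
        intro y hy _
        rw [show y = b + 1 by omega]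
        exact hP0 _ hbS
      | succ k ih =>
        intro y hy hay
        rw [← hst y (hI _ (by omega) (by omega))]
        exact ih _ (by omega) (by omega)
    apply hx
    rcases Nat.mod_two_eq_zero_or_one (x - a) with h0 | h0
    · exact hdn ((b + 1 - x) / 2) x (by omega) ha
    · have := hup ((x - a) / 2) (by omega)
      rwa [show a + 2 * ((x - a) / 2) + 1 = x by omega] at this
end

section
/- Let n ≥ 1 and let Γ be the n×n matrix over ZMod 2 with all off-diagonal entries 1 and zero diagonal. Then the number of subsets S ⊆ Fin n such that the principal submatrix of Γ obtained by deleting the rows and columns indexed by S is invertible over ZMod 2 equals 2^{n−1}. -/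
/-- The adjacency matrix of the complete graph on `n` vertices over `ZMod 2`:
all off-diagonal entries are `1`, the diagonal is `0`. -/
def cliqueAdj (n : ℕ) : Matrix (Fin n) (Fin n) (ZMod 2) :=
  Matrix.of fun i j => if i = j then 0 else 1

theorem prinSub_cliqueAdj_apply {n : ℕ} (S : Finset (Fin n)) (i j : {i // i ∈ Sᶜ}) :
    prinSub (cliqueAdj n) S i j = 1 + (if i = j then 1 else 0) := by
  have h2 : (1 : ZMod 2) + 1 = 0 := by decide
  by_cases h : i = j
  · simp [prinSub, cliqueAdj, h, h2]
  · have h' : i.val ≠ j.val := fun e => h (Subtype.ext e)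
    simp [prinSub, cliqueAdj, h, h']

theorem isUnit_prinSub_iff {n : ℕ} (S : Finset (Fin n)) :
    IsUnit (prinSub (cliqueAdj n) S) ↔ Even (Sᶜ).card := by
  have h2 : (1 : ZMod 2) + 1 = 0 := by decide
  constructor
  · intro h
    by_contra hodd
    rw [Nat.not_even_iff_odd] at hodd
    have hc : (((Sᶜ).card : ℕ) : ZMod 2) = 1 := (ZMod.natCast_eq_one_iff_odd).2 hodd
    have hv : (prinSub (cliqueAdj n) S).mulVec (fun _ => 1) = 0 := by
      funext i
      simp only [Matrix.mulVec, dotProduct, prinSub_cliqueAdj_apply, mul_one,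
        Finset.sum_add_distrib, Finset.sum_ite_eq, Finset.mem_univ, if_true, Finset.sum_const,
        Finset.card_univ, Fintype.card_coe, nsmul_eq_mul, hc, h2, Pi.zero_apply]
    have hinj := Matrix.mulVec_injective_of_isUnit h
    have h0 : (fun _ : {i // i ∈ Sᶜ} => (1 : ZMod 2)) = 0 := by
      apply hinj
      rw [hv, Matrix.mulVec_zero]
    obtain ⟨x, hx⟩ := Finset.card_pos.1 hodd.pos
    have := congrFun h0 ⟨x, hx⟩
    simp at this
  · intro heven
    have hc : (((Sᶜ).card : ℕ) : ZMod 2) = 0 := (ZMod.natCast_eq_zero_iff_even).2 heven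
    have hm : prinSub (cliqueAdj n) S * prinSub (cliqueAdj n) S = 1 := by
      ext i j
      simp only [Matrix.mul_apply, prinSub_cliqueAdj_apply, mul_add, add_mul, one_mul, mul_one,
        Finset.sum_add_distrib, Finset.sum_ite_eq, Finset.sum_ite_eq', Finset.mem_univ, if_true,
        Finset.sum_const, Finset.card_univ, Fintype.card_coe, nsmul_eq_mul, hc, ite_mul, zero_mul,
        Matrix.one_apply]
      split_ifs <;> decide
    exact IsUnit.of_mul_eq_one _ hm

theorem card_even_compl (n : ℕ) (hn : 1 ≤ n) :
    (Finset.univ.filter fun S : Finset (Fin n) => Even (Sᶜ).card).card = 2 ^ (n - 1) := by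
  have hne : (Finset.univ : Finset (Fin n)).Nonempty := ⟨⟨0, hn⟩, Finset.mem_univ _⟩
  have h0 := Finset.sum_powerset_neg_one_pow_card_of_nonempty hne
  rw [Finset.powerset_univ] at h0
  have h1 : ∑ S : Finset (Fin n), (-1 : ℤ) ^ (Sᶜ).card = 0 := by
    rw [← h0]
    exact Equiv.sum_comp (Equiv.ofBijective _ (compl_bijective (α := Finset (Fin n))))
      (fun S => (-1 : ℤ) ^ S.card)
  have h3 : ∀ S : Finset (Fin n), (-1 : ℤ) ^ (Sᶜ).card
      = 2 * (if Even (Sᶜ).card then 1 else 0) - 1 := by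
    intro S
    split_ifs with h
    · rw [h.neg_one_pow]; norm_num
    · rw [(Nat.not_even_iff_odd.1 h).neg_one_pow]; norm_num
  simp only [h3] at h1
  rw [Finset.sum_sub_distrib, ← Finset.mul_sum, Finset.sum_boole, Finset.sum_const,
    Finset.card_univ, Fintype.card_finset, Fintype.card_fin] at h1
  obtain ⟨m, rfl⟩ : ∃ m, n = m + 1 := ⟨n - 1, by omega⟩
  simp only [nsmul_eq_mul, mul_one, pow_succ] at h1
  push_cast at h1
  rw [Nat.add_sub_cancel]
  zify
  linarith

theorem stmt8 (n : ℕ) (hn : 1 ≤ n) :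
    Nat.card {S : Finset (Fin n) // IsUnit (prinSub (cliqueAdj n) S)} = 2 ^ (n - 1) := by
  simp only [isUnit_prinSub_iff]
  rw [Nat.card_eq_fintype_card, Fintype.card_subtype]
  exact card_even_compl n hn
end

section
/- Let n ≥ 0 and let Γ be the n×n adjacency matrix over ZMod 2 of the path graph (Γ_{ij} = 1 iff |i−j| = 1). Let K_n be the number of pairs (S, v), where S ⊆ Fin n and v ∈ (ZMod 2)^n with v_i = 0 for all i ∈ S, such that the principal submatrix on the complement of S of the matrix obtained from Γ by replacing its diagonal with v is invertible over ZMod 2. Then K_0 = 1, K_1 = 2, and K_n = 2·(K_{n−1} + K_{n−2}) for all n ≥ 2. -/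
/-- Full-size matrix encoding a choice word: `none` is `I`, `some v` is diagonal value `v`. -/
noncomputable def wordMat {n : ℕ} (f : Fin n → Option (ZMod 2)) : Matrix (Fin n) (Fin n) (ZMod 2) :=
  Matrix.of fun i j =>
    match f i with
    | none => if i = j then 1 else 0
    | some v => if i = j then v else pathAdj n i j

/-- Secondary state: the determinant of the tail if the first letter is not `none`. -/
noncomputable def wordE : {n : ℕ} → (Fin n → Option (ZMod 2)) → ZMod 2
  | 0, _ => 0
  | _ + 1, f => match f 0 with
    | none => 0
    | some _ => (wordMat (Fin.tail f)).det

lemma wordMat_cons_succ {n : ℕ} (a : Option (ZMod 2)) (g : Fin n → Option (ZMod 2)) :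
    (wordMat (Fin.cons a g : Fin (n+1) → Option (ZMod 2))).submatrix Fin.succ Fin.succ
      = wordMat g := by
  ext i j
  simp [wordMat, pathAdj]

lemma det_cons_none {n : ℕ} (g : Fin n → Option (ZMod 2)) :
    (wordMat (Fin.cons none g : Fin (n+1) → Option (ZMod 2))).det = (wordMat g).det := by
  rw [Matrix.det_succ_row_zero, Fin.sum_univ_succ, Finset.sum_eq_zero]
  · have := wordMat_cons_succ none g
    simp only [Fin.succAbove_zero, this]
    simp [wordMat]
  · intro j _
    have : wordMat (Fin.cons none g : Fin (n+1) → Option (ZMod 2)) 0 j.succ = 0 := by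
      simp [wordMat, (Fin.succ_ne_zero j).symm]
    simp [this]

lemma det_cons_some {n : ℕ} (v : ZMod 2) (g : Fin n → Option (ZMod 2)) :
    (wordMat (Fin.cons (some v) g : Fin (n+1) → Option (ZMod 2))).det
      = v * (wordMat g).det + wordE g := by
  cases n with
  | zero => simp [wordMat, wordE]
  | succ n =>
  have h1 := wordMat_cons_succ (some v) g
  rw [Matrix.det_succ_row_zero, Fin.sum_univ_succ, Fin.sum_univ_succ, Finset.sum_eq_zero]
  · simp only [Fin.succAbove_zero, h1]
    have h2 : ((wordMat (Fin.cons (some v) g : Fin (n+2) → Option (ZMod 2))).submatrix Fin.succ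
        (Fin.succ (0 : Fin (n+1))).succAbove).det = wordE g := by
      rw [Matrix.det_succ_column_zero, Fin.sum_univ_succ, Finset.sum_eq_zero]
      · have h3 : (((wordMat (Fin.cons (some v) g : Fin (n+2) → Option (ZMod 2))).submatrix Fin.succ
          (Fin.succ (0 : Fin (n+1))).succAbove).submatrix (Fin.succAbove 0) Fin.succ)
            = wordMat (Fin.tail g) := by
          rw [← wordMat_cons_succ (g 0) (Fin.tail g), Fin.cons_self_tail, 
            ← wordMat_cons_succ (some v) g]
          ext i j
          simp [Matrix.submatrix_apply]
        rw [h3]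
        rcases h : g 0 with _ | w
        · simp [wordE, h, wordMat]
        · simp [wordE, h, wordMat, pathAdj]
      · intro i _
        have : wordMat (Fin.cons (some v) g : Fin (n+2) → Option (ZMod 2)) i.succ.succ 0 = 0 := by
          rcases h : g i.succ with _ | w <;> simp [wordMat, pathAdj, h]
        simp [this]
    rw [h2]
    have h4 : (-1 : ZMod 2) = 1 := by decide
    simp [wordMat, pathAdj, h4]
  · intro j _
    have : wordMat (Fin.cons (some v) g : Fin (n+2) → Option (ZMod 2)) 0 j.succ.succ = 0 := by
      have : (0 : Fin (n+2)) ≠ j.succ.succ := (Fin.succ_ne_zero _).symm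
      simp [wordMat, pathAdj, this]
    simp [this]

lemma wordE_cons_none {n : ℕ} (g : Fin n → Option (ZMod 2)) :
    wordE (Fin.cons none g : Fin (n+1) → Option (ZMod 2)) = 0 := by
  simp [wordE]

lemma wordE_cons_some {n : ℕ} (v : ZMod 2) (g : Fin n → Option (ZMod 2)) :
    wordE (Fin.cons (some v) g : Fin (n+1) → Option (ZMod 2)) = (wordMat g).det := by
  simp [wordE]

/-- Number of words with determinant one. -/
noncomputable def cntD (n : ℕ) : ℕ :=
  ∑ f : Fin n → Option (ZMod 2), if (wordMat f).det = 1 then 1 else 0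

/-- Number of words in state `(0, 1)`. -/
noncomputable def cntE (n : ℕ) : ℕ :=
  ∑ f : Fin n → Option (ZMod 2), if (wordMat f).det = 0 ∧ wordE f = 1 then 1 else 0

lemma sum_words (n : ℕ) (F : (Fin (n+1) → Option (ZMod 2)) → ℕ) :
    ∑ f, F f = ∑ g : Fin n → Option (ZMod 2),
      (F (Fin.cons none g) + (F (Fin.cons (some 0) g) + F (Fin.cons (some 1) g))) := by
  rw [← (Fin.consEquiv (fun _ => Option (ZMod 2))).sum_comp, Fintype.sum_prod_type_right]
  refine Finset.sum_congr rfl fun g _ => ?_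
  rw [Fintype.sum_option]
  congr 1

lemma cntD_succ (n : ℕ) : cntD (n+1) = 2 * (cntD n + cntE n) := by
  unfold cntD cntE
  rw [sum_words, ← Finset.sum_add_distrib, Finset.mul_sum]
  refine Finset.sum_congr rfl fun g _ => ?_
  simp only [det_cons_none, det_cons_some]
  generalize (wordMat g).det = d
  generalize wordE g = e
  revert d e
  decide

lemma cntE_succ (n : ℕ) : cntE (n+1) = cntD n := by
  unfold cntD cntE
  rw [sum_words]
  refine Finset.sum_congr rfl fun g _ => ?_
  simp only [det_cons_none, det_cons_some, wordE_cons_none, wordE_cons_some]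
  generalize (wordMat g).det = d
  generalize wordE g = e
  revert d e
  decide

/-- The word of a pair. -/
def toWord {n : ℕ} (p : Finset (Fin n) × (Fin n → ZMod 2)) : Fin n → Option (ZMod 2) :=
  fun i => if i ∈ p.1 then none else some (p.2 i)

lemma det_toWord {n : ℕ} (p : Finset (Fin n) × (Fin n → ZMod 2)) :
    (wordMat (toWord p)).det = (prinSub (withDiag (pathAdj n) p.2) p.1).det := by
  rw [Matrix.twoBlockTriangular_det (wordMat (toWord p)) (fun i => i ∈ p.1ᶜ)]
  · have h1 : Matrix.toSquareBlockProp (wordMat (toWord p)) (fun i => i ∈ p.1ᶜ)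
        = prinSub (withDiag (pathAdj n) p.2) p.1 := by
      ext ⟨i, hi⟩ ⟨j, hj⟩
      have hi' : i ∉ p.1 := by simpa using hi
      simp [Matrix.toSquareBlockProp, prinSub, withDiag, wordMat, toWord, hi']
    have h2 : Matrix.toSquareBlockProp (wordMat (toWord p)) (fun i => ¬ i ∈ p.1ᶜ) = 1 := by
      ext ⟨i, hi⟩ ⟨j, hj⟩
      have hi' : i ∈ p.1 := by simpa using hi
      simp [Matrix.toSquareBlockProp, wordMat, toWord, hi', Matrix.one_apply]
    rw [h1, h2, Matrix.det_one, mul_one]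
    congr!
  · intro i hi j hj
    have hi' : i ∈ p.1 := by simpa using hi
    have hj' : j ∉ p.1 := by simpa using hj
    have : i ≠ j := by rintro rfl; exact hj' hi'
    simp [wordMat, toWord, hi', this]

lemma isUnit_iff_word {n : ℕ} (p : Finset (Fin n) × (Fin n → ZMod 2)) :
    IsUnit (prinSub (withDiag (pathAdj n) p.2) p.1) ↔ (wordMat (toWord p)).det = 1 := by
  rw [Matrix.isUnit_iff_isUnit_det, ← det_toWord, isUnit_iff_ne_zero]
  generalize (wordMat (toWord p)).det = d
  revert d
  decide

lemma card_eq_cntD (n : ℕ) : Nat.card {p : Finset (Fin n) × (Fin n → ZMod 2) //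
        (∀ i ∈ p.1, p.2 i = 0) ∧ IsUnit (prinSub (withDiag (pathAdj n) p.2) p.1)} = cntD n := by
  have h : cntD n = Nat.card {f : Fin n → Option (ZMod 2) // (wordMat f).det = 1} := by
    rw [Nat.card_eq_fintype_card, Fintype.card_subtype, Finset.card_filter, cntD]
  rw [h]
  refine Nat.card_eq_of_bijective (fun p => ⟨toWord p.1, (isUnit_iff_word p.1).1 p.2.2⟩) ⟨?_, ?_⟩
  · rintro ⟨⟨S, v⟩, h1, h2⟩ ⟨⟨T, w⟩, h3, h4⟩ h
    have h' : ∀ i, toWord (S, v) i = toWord (T, w) i := fun i => congrFun (Subtype.ext_iff.1 h) i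
    simp only [toWord] at h'
    simp only at h1 h3
    have hS : S = T := by
      ext i
      have := h' i
      by_cases a : i ∈ S <;> by_cases b : i ∈ T <;> simp_all
    subst hS
    have hv : v = w := by
      ext i
      have := h' i
      by_cases a : i ∈ S
      · rw [h1 i a, h3 i a]
      · simp_all
    subst hv
    rfl
  · rintro ⟨f, hf⟩
    have key : toWord (Finset.univ.filter (fun i => f i = none), fun i => (f i).getD 0) = f := by
      funext i
      rcases h : f i with _ | a <;> simp [toWord, h]
    refine ⟨⟨(Finset.univ.filter (fun i => f i = none), fun i => (f i).getD 0), ?_, ?_⟩, ?_⟩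
    · intro i hi
      have : f i = none := by simpa using hi
      simp [this]
    · rw [isUnit_iff_word, key]; exact hf
    · exact Subtype.ext key

theorem stmt12 (K : ℕ → ℕ)
    (hK : ∀ n, K n = Nat.card {p : Finset (Fin n) × (Fin n → ZMod 2) //
        (∀ i ∈ p.1, p.2 i = 0) ∧ IsUnit (prinSub (withDiag (pathAdj n) p.2) p.1)}) :
    K 0 = 1 ∧ K 1 = 2 ∧ ∀ n, 2 ≤ n → K n = 2 * (K (n - 1) + K (n - 2)) := by
  have hc : ∀ n, K n = cntD n := fun n => (hK n).trans (card_eq_cntD n)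
  have h0 : cntD 0 = 1 := by simp [cntD]
  have e0 : cntE 0 = 0 := by simp [cntE]
  refine ⟨by rw [hc, h0], by rw [hc, cntD_succ, h0, e0], ?_⟩
  intro n hn
  obtain ⟨m, rfl⟩ := Nat.exists_eq_add_of_le' hn
  have : m + 2 - 1 = m + 1 := by omega
  rw [this, Nat.add_sub_cancel, hc, hc, hc, cntD_succ (m+1), cntE_succ]
end

section
/- Let n, m ≥ 1 and let Γ be the (n+m)×(n+m) adjacency matrix over ZMod 2 of the n clique-line-m clique graph (Γ_{ij} = 1 iff i ≠ j and i,j ∈ {0,…,n−1}, or i ≠ j and i,j ∈ {n,…,n+m−1}, or {i,j} = {n−1,n}). Then Γ is invertible over ZMod 2 if and only if n + m is even. -/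
theorem clc_ll (p q : ℕ) (i j : Fin (p+1)) :
    clcAdj (p+1) (q+1) (Fin.castAdd (q+1) i) (Fin.castAdd (q+1) j)
      = 1 + if i = j then 1 else 0 := by
  have := i.2
  have := j.2
  by_cases h : i = j
  · subst h
    simp [clcAdj]
    decide
  · simp [clcAdj, h]
    omega

theorem clc_rr (p q : ℕ) (i j : Fin (q+1)) :
    clcAdj (p+1) (q+1) (Fin.natAdd (p+1) i) (Fin.natAdd (p+1) j)
      = 1 + if i = j then 1 else 0 := by
  by_cases h : i = j
  · subst h
    simp [clcAdj]
    decide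
  · simp [clcAdj, h]
    intros
    omega

theorem clc_lr (p q : ℕ) (i : Fin (p+1)) (j : Fin (q+1)) :
    clcAdj (p+1) (q+1) (Fin.castAdd (q+1) i) (Fin.natAdd (p+1) j)
      = if i = Fin.last p then (if j = 0 then 1 else 0) else 0 := by
  have := i.2
  rw [← ite_and]
  simp only [clcAdj, Matrix.of_apply]
  congr 1
  simp only [Fin.ext_iff, ne_eq, Fin.val_castAdd, Fin.val_natAdd, Fin.val_last, Fin.val_zero,
    eq_iff_iff]
  omega

theorem clc_rl (p q : ℕ) (i : Fin (q+1)) (j : Fin (p+1)) :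
    clcAdj (p+1) (q+1) (Fin.natAdd (p+1) i) (Fin.castAdd (q+1) j)
      = if i = 0 then (if j = Fin.last p then 1 else 0) else 0 := by
  have := j.2
  rw [← ite_and]
  simp only [clcAdj, Matrix.of_apply]
  congr 1
  simp only [Fin.ext_iff, ne_eq, Fin.val_castAdd, Fin.val_natAdd, Fin.val_last, Fin.val_zero,
    eq_iff_iff]
  omega

theorem clc_mulVec_l (p q : ℕ) (v : Fin (p+1+(q+1)) → ZMod 2) (i : Fin (p+1)) :
    (clcAdj (p+1) (q+1)).mulVec v (Fin.castAdd (q+1) i) =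
      (∑ j, v (Fin.castAdd (q+1) j)) + v (Fin.castAdd (q+1) i)
        + if i = Fin.last p then v (Fin.natAdd (p+1) 0) else 0 := by
  rw [Matrix.mulVec, dotProduct, Fin.sum_univ_add]
  simp only [clc_ll, clc_lr, add_mul, Finset.sum_add_distrib]
  split_ifs <;> simp

theorem clc_mulVec_r (p q : ℕ) (v : Fin (p+1+(q+1)) → ZMod 2) (i : Fin (q+1)) :
    (clcAdj (p+1) (q+1)).mulVec v (Fin.natAdd (p+1) i) =
      (∑ j, v (Fin.natAdd (p+1) j)) + v (Fin.natAdd (p+1) i)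
        + if i = 0 then v (Fin.castAdd (q+1) (Fin.last p)) else 0 := by
  rw [Matrix.mulVec, dotProduct, Fin.sum_univ_add]
  simp only [clc_rr, clc_rl, add_mul, Finset.sum_add_distrib]
  split_ifs <;> simp [add_comm]

theorem clc_key : ∀ p q S T a b : ZMod 2, p + q = 0 → S = (p+1)*S + b → T = (q+1)*T + a →
    S + a + b = 0 → T + b + a = 0 → S = 0 ∧ T = 0 ∧ a = 0 ∧ b = 0 := by decide

theorem clc_move : ∀ s x c : ZMod 2, s + x + c = 0 → x = s + c := by decide

theorem stmt16 (n m : ℕ) (hn : 1 ≤ n) (hm : 1 ≤ m) :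
    IsUnit (clcAdj n m) ↔ Even (n + m) := by
  obtain ⟨p, rfl⟩ : ∃ p, n = p + 1 := ⟨n - 1, by omega⟩
  obtain ⟨q, rfl⟩ : ∃ q, m = q + 1 := ⟨m - 1, by omega⟩
  have hpar : Even (p + 1 + (q + 1)) ↔ (p : ZMod 2) + q = 0 := by
    rw [← Nat.cast_add, ZMod.natCast_eq_zero_iff_even]
    grind
  rw [hpar, ← Matrix.mulVec_injective_iff_isUnit]
  constructor
  · intro hinj
    by_contra hne
    have h1 : ∀ a b : ZMod 2, a + b ≠ 0 → a + b = 1 := by decide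
    have hpq := h1 _ _ hne
    let v : Fin (p+1+(q+1)) → ZMod 2 := Fin.append
      (fun i : Fin (p+1) => 1 + if i = Fin.last p then (q : ZMod 2) + 1 else 0)
      (fun j : Fin (q+1) => 1 + if j = 0 then (p : ZMod 2) + 1 else 0)
    have hv : (clcAdj (p+1) (q+1)).mulVec v = 0 := by
      funext k
      refine Fin.addCases (fun i => ?_) (fun i => ?_) k
      · rw [clc_mulVec_l]
        simp only [v, Fin.append_left, Fin.append_right, Finset.sum_add_distrib]
        simp
        generalize (p : ZMod 2) = a at *
        generalize (q : ZMod 2) = b at *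
        split_ifs <;> (clear v hinj hpar hne h1; revert a b; decide)
      · rw [clc_mulVec_r]
        simp only [v, Fin.append_left, Fin.append_right, Finset.sum_add_distrib]
        simp
        generalize (p : ZMod 2) = a at *
        generalize (q : ZMod 2) = b at *
        split_ifs <;> (clear v hinj hpar hne h1; revert a b; decide)
    have h0 : v = 0 := hinj (by simpa using hv)
    have e1 := congrFun h0 (Fin.castAdd (q+1) (Fin.last p))
    have e2 := congrFun h0 (Fin.natAdd (p+1) 0)
    simp only [v, Fin.append_left, Fin.append_right, if_true, Pi.zero_apply] at e1 e2
    clear h0 hv v hinj hpar hne h1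
    generalize (p : ZMod 2) = a at *
    generalize (q : ZMod 2) = b at *
    revert a b
    decide
  · intro h
    have hker : ∀ v, (clcAdj (p+1) (q+1)).mulVec v = 0 → v = 0 := by
      intro v hv
      have hx : ∀ i, _ := fun i => clc_move _ _ _
        ((clc_mulVec_l p q v i).symm.trans (congrFun hv _))
      have hy : ∀ i, _ := fun i => clc_move _ _ _
        ((clc_mulVec_r p q v i).symm.trans (congrFun hv _))
      have l := clc_mulVec_l p q v (Fin.last p)
      have r := clc_mulVec_r p q v 0
      rw [hv] at l r
      simp only [if_true, Pi.zero_apply] at l r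
      have sx := Finset.sum_congr (rfl : (Finset.univ : Finset (Fin (p+1))) = _) fun i _ => hx i
      have sy := Finset.sum_congr (rfl : (Finset.univ : Finset (Fin (q+1))) = _) fun i _ => hy i
      rw [Finset.sum_add_distrib] at sx sy
      simp only [Finset.sum_const, Finset.card_univ, Fintype.card_fin, nsmul_eq_mul,
        Finset.sum_ite_eq', Finset.mem_univ, if_true, Nat.cast_add, Nat.cast_one] at sx sy
      obtain ⟨hS, hT, ha, hb⟩ := clc_key _ _ _ _ _ _ h sx sy l.symm r.symm
      funext k
      refine Fin.addCases (fun i => ?_) (fun i => ?_) k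
      · rw [hx, hS, hb]; simp
      · rw [hy, hT, ha]; simp
    intro v w hvw
    have := hker (v - w) (by rw [Matrix.mulVec_sub]; exact sub_eq_zero.2 hvw)
    exact sub_eq_zero.1 this
end

section
/- Let n ≥ 0. Define K^H_t = 1 if t is even and K^H_t = 0 if t is odd (with K^H_0 = 1), and let K^{IH}_n denote the number of subsets S ⊆ Fin n such that the principal submatrix, on the complement of S, of the path-graph adjacency matrix over ZMod 2 (entries 1 exactly at |i−j| = 1) is invertible. Then for all n ≥ 1, K^{IH}_n = K^H_n + Σ_{i=0}^{n−1} K^H_{n−1−i} · K^{IH}_i. -/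
/-- Kernel form of invertibility of the principal submatrix off `f = true`. -/
def QK (n : ℕ) (f : Fin n → Bool) : Prop :=
  ∀ v : Fin n → ZMod 2, (∀ i, f i = true → v i = 0) →
    (∀ i, f i = false → ∑ j, pathAdj n i j * v j = 0) → v = 0

lemma pa_succ (n : ℕ) (i j : Fin n) : pathAdj (n+1) i.succ j.succ = pathAdj n i j := by
  simp [pathAdj]

lemma pa_zero (n : ℕ) : pathAdj (n+1) 0 0 = 0 := by
  simp [pathAdj]

lemma pa_01 (n : ℕ) : pathAdj (n+2) 0 (Fin.succ 0) = 1 := by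
  simp [pathAdj]

lemma pa_10 (n : ℕ) : pathAdj (n+2) (Fin.succ 0) 0 = 1 := by
  simp [pathAdj]

lemma pa_0s (n : ℕ) (j : Fin n) : pathAdj (n+2) 0 j.succ.succ = 0 := by
  simp [pathAdj]

lemma pa_s0 (n : ℕ) (j : Fin n) : pathAdj (n+2) j.succ.succ 0 = 0 := by
  simp [pathAdj]

lemma isUnit_iff_QK (n : ℕ) (S : Finset (Fin n)) :
    IsUnit (prinSub (pathAdj n) S) ↔ QK n (fun i => decide (i ∈ S)) := by
  rw [← Matrix.mulVec_injective_iff_isUnit]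
  have key : ∀ v : Fin n → ZMod 2, (∀ i ∈ S, v i = 0) → ∀ i : {i // i ∈ Sᶜ},
      (prinSub (pathAdj n) S).mulVec (fun j => v j.1) i = ∑ j, pathAdj n i.1 j * v j := by
    intro v hv i
    simp only [Matrix.mulVec, dotProduct, prinSub, Matrix.submatrix_apply]
    rw [Finset.sum_coe_sort Sᶜ (fun j => pathAdj n i.1 j * v j)]
    apply Finset.sum_subset (Finset.subset_univ _)
    intro j _ hj
    rw [hv j (by simpa using hj), mul_zero]
  constructor
  · intro h v hv hw
    have hv' : ∀ i ∈ S, v i = 0 := fun i hi => hv i (by simpa using hi)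
    have h0 : (fun j : {i // i ∈ Sᶜ} => v j.1) = 0 := by
      apply h
      rw [Matrix.mulVec_zero]
      funext i
      rw [key v hv' i]
      exact hw i.1 (by simpa using Finset.mem_compl.1 i.2)
    funext i
    by_cases hi : i ∈ S
    · exact hv' i hi
    · exact congrFun h0 ⟨i, by simpa using hi⟩
  · intro h
    have : Function.Injective (Matrix.mulVecLin (prinSub (pathAdj n) S)) := by
      rw [injective_iff_map_eq_zero]
      intro u hu
      set v : Fin n → ZMod 2 := fun i => if hi : i ∈ Sᶜ then u ⟨i, hi⟩ else 0 with hvdef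
      have hv' : ∀ i ∈ S, v i = 0 := by
        intro i hi
        simp [hvdef, hi]
      have huv : (fun j : {i // i ∈ Sᶜ} => v j.1) = u := by
        funext j
        have := j.2
        simp only [hvdef, dif_pos this]
      have hz := h v (fun i hi => hv' i (by simpa using hi)) (by
        intro i hi
        have hi' : i ∈ Sᶜ := by simpa using hi
        have := key v hv' ⟨i, hi'⟩
        rw [← this, huv]
        exact congrFun hu _)
      rw [← huv, hz]
      rfl
    exact this

lemma QK_true (n : ℕ) (g : Fin n → Bool) :
    QK (n+1) (Fin.cons true g : Fin (n+1) → Bool) ↔ QK n g := by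
  constructor
  · intro h v hv hw
    have := h (Fin.cons 0 v : Fin (n+1) → ZMod 2)
      (by intro i; refine Fin.cases ?_ (fun i => ?_) i <;> simp +contextual [hv])
      (by
        intro i
        refine Fin.cases ?_ (fun i => ?_) i
        · simp
        · intro hi
          simp only [Fin.cons_succ] at hi
          simpa [Fin.sum_univ_succ, pa_succ] using hw i hi)
    funext i
    simpa using congrFun this i.succ
  · intro h v hv hw
    have h0 : v 0 = 0 := hv 0 (by simp)
    have := h (fun i => v i.succ) (fun i hi => hv i.succ (by simpa using hi))
      (by
        intro i hi
        simpa [Fin.sum_univ_succ (n := n), pa_succ, h0] using hw i.succ (by simpa using hi))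
    funext i
    refine Fin.cases h0 (fun i => ?_) i
    exact congrFun this i

lemma QK_ff (n : ℕ) (g : Fin n → Bool) :
    QK (n+2) (Fin.cons false (Fin.cons false g : Fin (n+1) → Bool) : Fin (n+2) → Bool) ↔
      QK n g := by
  constructor
  · intro h v hv hw
    have := h (Fin.cons (- ∑ j : Fin n, pathAdj (n+2) (Fin.succ 0) j.succ.succ * v j)
        (Fin.cons 0 v : Fin (n+1) → ZMod 2) : Fin (n+2) → ZMod 2)
      (by
        intro i
        refine Fin.cases ?_ (fun i => ?_) i
        · simp
        · refine Fin.cases ?_ (fun i => ?_) i <;> simp +contextual only [Fin.cons_succ, Fin.cons_zero] <;> simp +contextual [hv])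
      (by
        intro i
        rw [Fin.sum_univ_succ, Fin.sum_univ_succ]
        simp only [Fin.cons_succ, Fin.cons_zero]
        refine Fin.cases ?_ (fun i => ?_) i
        · simp only [pa_zero, pa_0s]; simp
        · refine Fin.cases ?_ (fun i => ?_) i
          · intro _
            rw [pa_10]; ring
          · intro hi
            simp only [Fin.cons_succ] at hi
            simp only [pa_s0, pa_succ, zero_mul, mul_zero, zero_add]
            exact hw i hi)
    funext i
    have := congrFun this i.succ.succ
    simp only [Fin.cons_succ] at this
    exact this
  · intro h v hv hw
    have h1 : v (Fin.succ 0) = 0 := by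
      have := hw 0 (by simp)
      rw [Fin.sum_univ_succ, Fin.sum_univ_succ] at this
      simpa only [pa_zero, pa_01, pa_0s, zero_mul, one_mul, zero_add, Finset.sum_const_zero,
        add_zero] using this
    have h2 := h (fun i => v i.succ.succ)
      (fun i hi => hv i.succ.succ (by simpa only [Fin.cons_succ] using hi))
      (by
        intro i hi
        have := hw i.succ.succ (by simpa only [Fin.cons_succ] using hi)
        rw [Fin.sum_univ_succ, Fin.sum_univ_succ] at this
        simpa only [pa_s0, pa_succ, h1, zero_mul, mul_zero, zero_add] using this)
    have h3 : ∀ i : Fin n, v i.succ.succ = 0 := fun i => congrFun h2 i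
    have h0 : v 0 = 0 := by
      have := hw (Fin.succ 0) (by simp only [Fin.cons_succ, Fin.cons_zero])
      rw [Fin.sum_univ_succ, Fin.sum_univ_succ] at this
      simpa only [pa_10, h1, h3, one_mul, mul_zero, Finset.sum_const_zero, add_zero] using this
    funext i
    refine Fin.cases h0 (fun i => ?_) i
    exact Fin.cases h1 h3 i

lemma QK_ft (n : ℕ) (g : Fin n → Bool) :
    ¬ QK (n+2) (Fin.cons false (Fin.cons true g : Fin (n+1) → Bool) : Fin (n+2) → Bool) := by
  intro h
  have := h (Fin.cons 1 (fun _ => 0) : Fin (n+2) → ZMod 2)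
    (by intro i; refine Fin.cases ?_ (fun i => ?_) i <;> simp)
    (by
      intro i
      rw [Fin.sum_univ_succ]
      simp only [Fin.cons_succ, Fin.cons_zero, mul_zero, Finset.sum_const_zero, add_zero, mul_one]
      refine Fin.cases ?_ (fun i => ?_) i
      · intro _; exact pa_zero _
      · refine Fin.cases ?_ (fun i => ?_) i
        · simp only [Fin.cons_succ, Fin.cons_zero]; simp
        · intro _; exact pa_s0 _ _)
  have := congrFun this 0
  simp at this

/-- The number of flags with trivial kernel. -/
noncomputable def cK (n : ℕ) : ℕ := by
  classical
  exact ∑ f : Fin n → Bool, if QK n f then 1 else 0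

lemma sum_cons_s17 (n : ℕ) (F : (Fin (n+1) → Bool) → ℕ) :
    ∑ f, F f = ∑ g : Fin n → Bool, F (Fin.cons true g : Fin (n+1) → Bool) +
      ∑ g : Fin n → Bool, F (Fin.cons false g : Fin (n+1) → Bool) := by
  rw [← Equiv.sum_comp (Fin.consEquiv (fun _ : Fin (n+1) => Bool)) F, Fintype.sum_prod_type]
  simp [Fin.consEquiv]

lemma cK_rec (n : ℕ) : cK (n+2) = cK (n+1) + cK n := by
  classical
  unfold cK
  rw [sum_cons_s17 (n+1), sum_cons_s17 n (fun g => if QK (n+2) (Fin.cons false g : Fin (n+2) → Bool) then 1 else 0)]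
  simp only [QK_true (n+1), QK_ff, QK_ft, if_false, Finset.sum_const_zero, zero_add]

lemma cK_zero : cK 0 = 1 := by
  classical
  have : ∀ f, QK 0 f := fun f v _ _ => Subsingleton.elim _ _
  simp [cK, this]

lemma cK_one : cK 1 = 1 := by
  classical
  have h0 : ∀ f, QK 0 f := fun f v _ _ => Subsingleton.elim _ _
  have h1 : ∀ g : Fin 0 → Bool, ¬ QK 1 (Fin.cons false g : Fin 1 → Bool) := by
    intro g h
    have := congrFun (h (fun _ => 1) (by intro i; fin_cases i; simp)
      (by intro i _; fin_cases i; simp [pathAdj])) 0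
    simp at this
  unfold cK
  rw [sum_cons_s17 0]
  simp [QK_true, h0, h1]

lemma card_eq_cK (n : ℕ) :
    Nat.card {S : Finset (Fin n) // IsUnit (prinSub (pathAdj n) S)} = cK n := by
  classical
  have e : {S : Finset (Fin n) // IsUnit (prinSub (pathAdj n) S)} ≃
      {f : Fin n → Bool // QK n f} :=
    { toFun := fun S => ⟨fun i => decide (i ∈ S.1), (isUnit_iff_QK n S.1).1 S.2⟩
      invFun := fun f => ⟨Finset.univ.filter (fun i => f.1 i = true), by
        rw [isUnit_iff_QK]
        simpa using f.2⟩
      left_inv := fun S => by ext; simp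
      right_inv := fun f => by ext; simp }
  rw [Nat.card_congr e, Nat.card_eq_fintype_card, Fintype.card_subtype, Finset.card_filter, cK]

theorem stmt17 (KH KIH : ℕ → ℕ)
    (hKH : ∀ t, KH t = if Even t then 1 else 0)
    (hKIH : ∀ k, KIH k = Nat.card {S : Finset (Fin k) // IsUnit (prinSub (pathAdj k) S)}) :
    ∀ n, 1 ≤ n → KIH n = KH n + ∑ i ∈ Finset.range n, KH (n - 1 - i) * KIH i := by
  have hK : ∀ k, KIH k = cK k := fun k => (hKIH k).trans (card_eq_cK k)
  have hall : ∀ n, KIH n = KH n + ∑ i ∈ Finset.range n, KH (n - 1 - i) * KIH i := by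
    intro n
    induction n using Nat.twoStepInduction with
    | zero => simp [hK, hKH, cK_zero]
    | one => simp [hK, hKH, cK_zero, cK_one]
    | more n ih _ =>
      have hper : ∀ t, KH (t+2) = KH t := by
        intro t
        simp [hKH, Nat.even_add]
      have hs : ∑ i ∈ Finset.range n, KH (n + 2 - 1 - i) * KIH i =
          ∑ i ∈ Finset.range n, KH (n - 1 - i) * KIH i := by
        apply Finset.sum_congr rfl
        intro i hi
        have := Finset.mem_range.1 hi
        rw [show n + 2 - 1 - i = (n - 1 - i) + 2 by omega, hper]
      rw [Finset.sum_range_succ, Finset.sum_range_succ, hs, hper]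
      rw [show n + 2 - 1 - n = 1 by omega, show n + 2 - 1 - (n+1) = 0 by omega]
      have k1 : KH 1 = 0 := by simp [hKH]
      have k0 : KH 0 = 1 := by simp [hKH]
      have hr : KIH (n+2) = KIH (n+1) + KIH n := by simp only [hK, cK_rec]
      rw [k1, k0, hr]
      omega
  exact fun n _ => hall n
end
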